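/- arXiv:1808.07266 — 12 statements merged into one kernel-verified Lean document; each statement's English description precedes it below -/
import Mathlib

section
/- Let K be a field, S = K[x_1,…,x_r], 𝔪 = (x_1,…,x_r), R = S[y], and let I ⊆ 𝔪² be an ideal of S with J = IR + 𝔪yR. Then for every n ≥ 1, g ∈ S and m ∈ ℕ: if m ≤ n then g·y^m ∈ J^n if and only if g ∈ I^{n−m}𝔪^m, and if m ≥ n then g·y^m ∈ J^n if and only if g ∈ 𝔪^n. (In other words, J^n = I^n ⊕ I^{n−1}𝔪y ⊕ ⋯ ⊕ I𝔪^{n−1}y^{n−1} ⊕ ⨁_{i≥0} 𝔪^n y^{n+i} with respect to the decomposition R = ⨁_{m≥0} S y^m.) -/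
open MvPolynomial Polynomial

theorem Ideal.pow_mul_pow_le_of_le {A : Type*} [CommRing A] {I M : Ideal A} (h : I ≤ M)
    {a b c d : ℕ} (hsum : a + b = c + d) (hca : c ≤ a) : I ^ a * M ^ b ≤ I ^ c * M ^ d := by
  obtain ⟨e, rfl⟩ := Nat.exists_eq_add_of_le hca
  obtain rfl : d = e + b := by omega
  rw [pow_add, pow_add, mul_assoc]
  exact Ideal.mul_mono_right (Ideal.mul_mono_left (Ideal.pow_right_mono h e))

theorem Polynomial.coeff_mem_of_mem_map_C_sup_pow {A : Type*} [CommRing A] {I M : Ideal A}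
    (h : I ≤ M) (n : ℕ) {p : A[X]}
    (hp : p ∈ (I.map (C : A →+* A[X]) ⊔ M.map (C : A →+* A[X]) * Ideal.span {X}) ^ n) (m : ℕ) :
    p.coeff m ∈ I ^ (n - m) * M ^ min m n := by
  induction n generalizing p m with
  | zero => simp
  | succ n ih =>
    rw [pow_succ] at hp
    induction hp using Submodule.mul_induction_on' with
    | mem_mul_mem p hp q hq =>
      rw [Polynomial.coeff_mul]
      refine Ideal.sum_mem _ fun ⟨i, j⟩ hij => ?_
      obtain rfl : i + j = m := by simpa using hij
      have hqj : q.coeff j ∈ I ^ (1 - j) * M ^ min j 1 := by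
        obtain ⟨a, ha, b, hb, rfl⟩ := Submodule.mem_sup.mp hq
        obtain ⟨c, hc, rfl⟩ := Ideal.mem_mul_span_singleton.mp hb
        rw [Ideal.mem_map_C_iff] at ha hc
        cases j with
        | zero => simpa using ha 0
        | succ j => simpa using M.add_mem (h (ha (j + 1))) (hc j)
      have hmul := Ideal.mul_mem_mul (ih hp i) hqj
      rw [mul_mul_mul_comm, ← pow_add, ← pow_add] at hmul
      exact Ideal.pow_mul_pow_le_of_le h (by omega) (by omega) hmul
    | add p _ q _ hp hq =>
      rw [Polynomial.coeff_add]
      exact add_mem hp hq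

theorem Polynomial.C_mul_X_pow_mem_map_C_sup_pow_iff {A : Type*} [CommRing A] {I M : Ideal A}
    (h : I ≤ M) (n m : ℕ) (g : A) :
    C g * X ^ m ∈ (I.map (C : A →+* A[X]) ⊔ M.map (C : A →+* A[X]) * Ideal.span {X}) ^ n ↔
      g ∈ I ^ (n - m) * M ^ min m n := by
  refine ⟨fun hg => by simpa using coeff_mem_of_mem_map_C_sup_pow h n hg m, fun hg => ?_⟩
  have hX : C g * X ^ m = C g * X ^ min m n * (X : A[X]) ^ (m - n) := by
    rw [mul_assoc, ← pow_add]
    congr 2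
    omega
  rw [hX]
  refine Ideal.mul_mem_right _ _ ?_
  have hmem := Ideal.mul_mem_mul (Ideal.mem_map_of_mem (C : A →+* A[X]) hg)
    (Ideal.pow_mem_pow (Ideal.mem_span_singleton_self (X : A[X])) (min m n))
  rw [Ideal.map_mul, Ideal.map_pow, Ideal.map_pow, mul_assoc, ← mul_pow] at hmem
  have hn : n = (n - m) + min m n := by omega
  conv => enter [1, 2]; rw [hn]
  rw [pow_add]
  exact Ideal.mul_mono (Ideal.pow_right_mono le_sup_left _)
    (Ideal.pow_right_mono le_sup_right _) hmem

theorem stmt_0 {K : Type*} [Field K] {r : ℕ}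
    (𝔪 : Ideal (MvPolynomial (Fin r) K))
    (h𝔪 : 𝔪 = Ideal.span (Set.range (X : Fin r → MvPolynomial (Fin r) K)))
    (I : Ideal (MvPolynomial (Fin r) K)) (hI : I ≤ 𝔪 ^ 2)
    (J : Ideal (Polynomial (MvPolynomial (Fin r) K)))
    (hJ : J = Ideal.map (Polynomial.C :
        MvPolynomial (Fin r) K →+* Polynomial (MvPolynomial (Fin r) K)) I ⊔
      Ideal.span (Set.range fun i : Fin r =>
        Polynomial.C (X i : MvPolynomial (Fin r) K) * Polynomial.X))
    (n : ℕ) (hn : 1 ≤ n) (g : MvPolynomial (Fin r) K) (m : ℕ) :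
    (m ≤ n → (Polynomial.C g * Polynomial.X ^ m ∈ J ^ n ↔ g ∈ I ^ (n - m) * 𝔪 ^ m)) ∧
    (n ≤ m → (Polynomial.C g * Polynomial.X ^ m ∈ J ^ n ↔ g ∈ 𝔪 ^ n)) := by
  have hspan : Ideal.span (Set.range fun i : Fin r =>
      Polynomial.C (X i : MvPolynomial (Fin r) K) * Polynomial.X) =
      𝔪.map Polynomial.C * Ideal.span {Polynomial.X} := by
    rw [h𝔪, Ideal.map_span, Ideal.span_mul_span', Set.mul_singleton, ← Set.range_comp,
      ← Set.range_comp]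
    rfl
  have key := Polynomial.C_mul_X_pow_mem_map_C_sup_pow_iff
    (hI.trans (Ideal.pow_le_self two_ne_zero)) n m g
  rw [← hspan, ← hJ] at key
  refine ⟨fun hmn => ?_, fun hnm => ?_⟩
  · rwa [min_eq_left hmn] at key
  · rwa [min_eq_right hnm, Nat.sub_eq_zero_of_le hnm, pow_zero, one_mul] at key
end

section
/- Let K be a field, S = K[x_1,…,x_r], 𝔪 = (x_1,…,x_r), R = S[y], and let I ⊆ 𝔪² be an ideal of S with J = IR + 𝔪yR. Then for every n ≥ 1 the colon ideal satisfies J^n : (y) = Σ_{k=1}^{n−1} I^{n−k}𝔪^k y^{k−1} R + 𝔪^n y^{n−1} R as ideals of R; equivalently, for g ∈ S and m ∈ ℕ, g·y^m ∈ J^n : (y) if and only if g ∈ I^{n−m−1}𝔪^{m+1} when m ≤ n−1, and if and only if g ∈ 𝔪^n when m ≥ n−1. -/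
open MvPolynomial Polynomial

/-- The ideal of polynomials whose coefficients lie in an increasing sequence of ideals. -/
def Polynomial.coeffIdeal {A : Type*} [CommRing A] (d : ℕ → Ideal A) (hd : Monotone d) :
    Ideal (Polynomial A) where
  carrier := {f | ∀ j, f.coeff j ∈ d j}
  add_mem' hf hg j := by
    rw [Polynomial.coeff_add]
    exact add_mem (hf j) (hg j)
  zero_mem' j := by simp
  smul_mem' c f hf j := by
    rw [smul_eq_mul, Polynomial.coeff_mul]
    exact sum_mem fun p hp => Ideal.mul_mem_left _ _
      (hd (le_of_le_of_eq le_add_self (Finset.HasAntidiagonal.mem_antidiagonal.1 hp)) (hf p.2))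

theorem Ideal.pow_tsub_mul_pow_min_mono {A : Type*} [CommRing A] {I M : Ideal A} (h : I ≤ M)
    (n : ℕ) : Monotone fun j => I ^ (n - j) * M ^ min j n := by
  refine monotone_nat_of_le_succ fun j => ?_
  rcases lt_or_ge j n with hj | hj
  · rw [min_eq_left hj.le, min_eq_left hj, show n - j = (n - (j + 1)) + 1 by omega,
      pow_succ, mul_assoc, pow_succ' M]
    exact Ideal.mul_mono le_rfl (Ideal.mul_mono h le_rfl)
  · rw [min_eq_right hj, min_eq_right (by omega), show n - j = n - (j + 1) by omega]

theorem Ideal.pow_tsub_mul_pow_min_mul_le {A : Type*} [CommRing A] {I M : Ideal A} (h : I ≤ M)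
    (n i j : ℕ) : (I ^ (n - i) * M ^ min i n) * (I ^ (1 - j) * M ^ min j 1) ≤
      I ^ (n + 1 - (i + j)) * M ^ min (i + j) (n + 1) := by
  rcases Nat.eq_zero_or_pos j with rfl | hj
  · rcases le_or_gt i n with hi | hi
    · rw [add_zero, min_eq_left hi, min_eq_left (by omega : i ≤ n + 1), Nat.sub_add_comm hi,
        pow_succ I (n - i)]
      simp only [tsub_zero, pow_one, zero_min, pow_zero, mul_one]
      exact le_of_eq (mul_right_comm _ _ _)
    · rw [add_zero, min_eq_right hi.le, min_eq_right (by omega : n + 1 ≤ i),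
        Nat.sub_eq_zero_of_le hi.le, Nat.sub_eq_zero_of_le (by omega : n + 1 ≤ i), pow_succ M]
      simpa using Ideal.mul_mono (le_refl (M ^ n)) h
  · refine le_trans (le_of_eq ?_)
      (Ideal.pow_tsub_mul_pow_min_mono h (n + 1) (show i + 1 ≤ i + j by omega))
    simp only
    rw [Nat.sub_eq_zero_of_le hj, min_eq_right (show 1 ≤ j from hj), Nat.add_sub_add_right,
      Nat.add_min_add_right, pow_succ M (min i n), pow_zero, pow_one, one_mul, mul_assoc]

/-- A monomial lies in the `n`-th power of `IA[X] + M X A[X]`, where `I ≤ M`, exactly when its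
coefficient lies in the expected product of powers. -/
theorem Polynomial.C_mul_X_pow_mem_pow_sup_iff {A : Type*} [CommRing A] {I M : Ideal A}
    (h : I ≤ M) (n j : ℕ) (a : A) :
    Polynomial.C a * Polynomial.X ^ j ∈
        (Ideal.map Polynomial.C I ⊔ Ideal.map Polynomial.C M * Ideal.span {Polynomial.X}) ^ n ↔
      a ∈ I ^ (n - j) * M ^ min j n := by
  set J : Ideal (Polynomial A) :=
    Ideal.map Polynomial.C I ⊔ Ideal.map Polynomial.C M * Ideal.span {Polynomial.X} with hJ
  constructor
  · have hJ1 : J ≤ Polynomial.coeffIdeal _ (Ideal.pow_tsub_mul_pow_min_mono h 1) := by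
      refine sup_le (Ideal.map_le_iff_le_comap.2 fun b hb k => ?_) ?_
      · rw [Polynomial.coeff_C]
        split_ifs with hk
        · simpa [hk] using hb
        · exact zero_mem _
      · rw [Ideal.map, Ideal.span_mul_span', Ideal.span_le]
        rintro _ ⟨_, ⟨b, hb, rfl⟩, _, rfl, rfl⟩ k
        simp only [Polynomial.coeff_C_mul, Polynomial.coeff_X]
        split_ifs with hk
        · simpa [← hk] using hb
        · simp
    have hJn : J ^ n ≤ Polynomial.coeffIdeal _ (Ideal.pow_tsub_mul_pow_min_mono h n) := by
      induction n with
      | zero => intro f _ k; simp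
      | succ n ih =>
        rw [pow_succ, Ideal.mul_le]
        intro f hf g hg k
        rw [Polynomial.coeff_mul]
        refine sum_mem fun p hp => ?_
        rw [← Finset.HasAntidiagonal.mem_antidiagonal.1 hp]
        exact Ideal.pow_tsub_mul_pow_min_mul_le h n p.1 p.2
          (Ideal.mul_mem_mul (ih hf p.1) (hJ1 hg p.2))
    intro ha
    simpa using hJn ha j
  · intro ha
    have hle : Ideal.map Polynomial.C (I ^ (n - j) * M ^ min j n) *
        Ideal.span {Polynomial.X} ^ min j n ≤ J ^ n := by
      rw [Ideal.map_mul, Ideal.map_pow, Ideal.map_pow, mul_assoc, ← mul_pow]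
      refine (Ideal.mul_mono (Ideal.pow_right_mono (le_sup_left.trans_eq hJ.symm) _)
        (Ideal.pow_right_mono (le_sup_right.trans_eq hJ.symm) _)).trans (le_of_eq ?_)
      rw [← pow_add]
      congr 1
      omega
    have hmem := hle (Ideal.mul_mem_mul (Ideal.mem_map_of_mem Polynomial.C ha)
      (Ideal.pow_mem_pow (Ideal.mem_span_singleton_self Polynomial.X) (min j n)))
    rw [← Nat.add_sub_cancel' (min_le_left j n), pow_add, ← mul_assoc]
    exact Ideal.mul_mem_right _ _ hmem

theorem stmt_1 {K : Type*} [Field K] {r : ℕ}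
    (𝔪 : Ideal (MvPolynomial (Fin r) K))
    (h𝔪 : 𝔪 = Ideal.span (Set.range (X : Fin r → MvPolynomial (Fin r) K)))
    (I : Ideal (MvPolynomial (Fin r) K)) (hI : I ≤ 𝔪 ^ 2)
    (J : Ideal (Polynomial (MvPolynomial (Fin r) K)))
    (hJ : J = Ideal.map (Polynomial.C :
        MvPolynomial (Fin r) K →+* Polynomial (MvPolynomial (Fin r) K)) I ⊔
      Ideal.span (Set.range fun i : Fin r =>
        Polynomial.C (X i : MvPolynomial (Fin r) K) * Polynomial.X))
    (n : ℕ) (hn : 1 ≤ n) (g : MvPolynomial (Fin r) K) (m : ℕ) :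
    (m ≤ n - 1 →
      (Polynomial.C g * Polynomial.X ^ m ∈
          (J ^ n).colon (Ideal.span {(Polynomial.X : Polynomial (MvPolynomial (Fin r) K))}) ↔
        g ∈ I ^ (n - m - 1) * 𝔪 ^ (m + 1))) ∧
    (n - 1 ≤ m →
      (Polynomial.C g * Polynomial.X ^ m ∈
          (J ^ n).colon (Ideal.span {(Polynomial.X : Polynomial (MvPolynomial (Fin r) K))}) ↔
        g ∈ 𝔪 ^ n)) := by
  have hIM : I ≤ 𝔪 := hI.trans (Ideal.pow_le_self two_ne_zero)
  have hJ' : J = Ideal.map Polynomial.C I ⊔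
      Ideal.map Polynomial.C 𝔪 * Ideal.span {Polynomial.X} := by
    rw [hJ, h𝔪, Ideal.map_span, Ideal.span_mul_span', Set.mul_singleton, ← Set.range_comp,
      ← Set.range_comp]
    rfl
  have hcolon : Polynomial.C g * Polynomial.X ^ m ∈
      (J ^ n).colon (Ideal.span {(Polynomial.X : Polynomial (MvPolynomial (Fin r) K))}) ↔
        g ∈ I ^ (n - (m + 1)) * 𝔪 ^ min (m + 1) n := by
    rw [← Polynomial.C_mul_X_pow_mem_pow_sup_iff hIM, ← hJ', Ideal.span, Submodule.colon_span,
      Submodule.mem_colon_singleton, smul_eq_mul, mul_assoc, ← pow_succ]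
  rw [hcolon]
  refine ⟨fun hm => ?_, fun hm => ?_⟩
  · rw [min_eq_left (by omega), Nat.sub_sub]
  · rw [min_eq_right (by omega), Nat.sub_eq_zero_of_le (by omega), pow_zero, one_mul]
end

section
/- Let K be a field, S = K[x_1,…,x_r], 𝔪 = (x_1,…,x_r), R = S[y], and let I ⊆ 𝔪² be a monomial ideal of S with J = IR + 𝔪yR. Fix n ≥ 1. If a ∈ ℕ^r and t, k ∈ ℕ are such that the monomial x^a y^{t+k} lies in J^n, then |a| ≥ n. Consequently, every monomial x^a y^t belonging to the saturation J^n : 𝔫^∞ = ∪_{k≥1}(J^n : 𝔫^k), where 𝔫 = (x_1,…,x_r,y), satisfies |a| ≥ n. -/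
open MvPolynomial Polynomial

theorem stmt_3 {K : Type*} [Field K] {r : ℕ}
    (𝔪 : Ideal (MvPolynomial (Fin r) K))
    (h𝔪 : 𝔪 = Ideal.span (Set.range (X : Fin r → MvPolynomial (Fin r) K)))
    (I : Ideal (MvPolynomial (Fin r) K)) (hI : I ≤ 𝔪 ^ 2)
    (hmono : ∃ A : Set (Fin r →₀ ℕ),
      I = Ideal.span ((fun a => (monomial a (1 : K) : MvPolynomial (Fin r) K)) '' A))
    (J : Ideal (Polynomial (MvPolynomial (Fin r) K)))
    (hJ : J = Ideal.map (Polynomial.C :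
        MvPolynomial (Fin r) K →+* Polynomial (MvPolynomial (Fin r) K)) I ⊔
      Ideal.span (Set.range fun i : Fin r =>
        Polynomial.C (X i : MvPolynomial (Fin r) K) * Polynomial.X))
    (𝔫 : Ideal (Polynomial (MvPolynomial (Fin r) K)))
    (h𝔫 : 𝔫 = Ideal.span
      (Set.range (fun i : Fin r =>
          Polynomial.C (X i : MvPolynomial (Fin r) K)) ∪
        {(Polynomial.X : Polynomial (MvPolynomial (Fin r) K))}))
    (n : ℕ) (hn : 1 ≤ n) :
    (∀ (a : Fin r →₀ ℕ) (t k : ℕ),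
      Polynomial.C (monomial a (1 : K)) * Polynomial.X ^ (t + k) ∈ J ^ n →
        n ≤ ∑ i, a i) ∧
    (∀ (a : Fin r →₀ ℕ) (t : ℕ),
      (∃ k ≥ 1, ∀ f ∈ 𝔫 ^ k,
        Polynomial.C (monomial a (1 : K)) * Polynomial.X ^ t * f ∈ J ^ n) →
        n ≤ ∑ i, a i) := by
  have hJm : J ≤ Ideal.map (Polynomial.C :
      MvPolynomial (Fin r) K →+* Polynomial (MvPolynomial (Fin r) K)) (idealOfVars (Fin r) K) := by
    rw [hJ]
    refine sup_le (Ideal.map_mono ?_) (Ideal.span_le.mpr ?_)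
    · rw [h𝔪] at hI
      exact hI.trans (Ideal.pow_le_self two_ne_zero)
    · rintro _ ⟨i, rfl⟩
      exact Ideal.mul_mem_right _ _
        (Ideal.mem_map_of_mem _ (Ideal.subset_span (Set.mem_range_self i)))
  have key : ∀ (a : Fin r →₀ ℕ) (m : ℕ),
      Polynomial.C (monomial a (1 : K)) * Polynomial.X ^ m ∈ J ^ n → n ≤ ∑ i, a i := by
    intro a m h
    have h' := Ideal.pow_right_mono hJm n h
    rw [← Ideal.map_pow, Ideal.mem_map_C_iff] at h'
    have hm := h' m
    rw [Polynomial.coeff_C_mul_X_pow, if_pos rfl] at hm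
    rw [mem_pow_idealOfVars_iff] at hm
    have := hm a (by simp)
    rwa [Finsupp.degree_eq_sum] at this
  refine ⟨fun a t k => key a (t + k), ?_⟩
  rintro a t ⟨k, -, h⟩
  refine key a (t + k) ?_
  rw [pow_add, ← mul_assoc]
  refine h _ (Ideal.pow_mem_pow ?_ k)
  rw [h𝔫]
  exact Ideal.subset_span (Or.inr rfl)
end

section
/- Let K be a field, r ≥ 1, S = K[x_1,…,x_r], 𝔪 = (x_1,…,x_r), R = S[y], 𝔫 = (x_1,…,x_r,y), and let J = 𝔪²R + 𝔪yR (i.e., J = (I, x_1y,…,x_ry) for I = 𝔪²). Then for every n ≥ 1 the saturation of J^n with respect to 𝔫 equals 𝔪^nR: for every f ∈ R, there exists k ≥ 1 with f·𝔫^k ⊆ J^n if and only if f ∈ 𝔪^nR. -/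
open MvPolynomial Polynomial

theorem stmt_4 {K : Type*} [Field K] {r : ℕ} (hr : 1 ≤ r)
    (𝔪 : Ideal (MvPolynomial (Fin r) K))
    (h𝔪 : 𝔪 = Ideal.span (Set.range (X : Fin r → MvPolynomial (Fin r) K)))
    (J : Ideal (Polynomial (MvPolynomial (Fin r) K)))
    (hJ : J = Ideal.map (Polynomial.C :
        MvPolynomial (Fin r) K →+* Polynomial (MvPolynomial (Fin r) K)) (𝔪 ^ 2) ⊔
      Ideal.span (Set.range fun i : Fin r =>
        Polynomial.C (X i : MvPolynomial (Fin r) K) * Polynomial.X))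
    (𝔫 : Ideal (Polynomial (MvPolynomial (Fin r) K)))
    (h𝔫 : 𝔫 = Ideal.span
      (Set.range (fun i : Fin r =>
          Polynomial.C (X i : MvPolynomial (Fin r) K)) ∪
        {(Polynomial.X : Polynomial (MvPolynomial (Fin r) K))}))
    (n : ℕ) (hn : 1 ≤ n) (f : Polynomial (MvPolynomial (Fin r) K)) :
    (∃ k ≥ 1, ∀ g ∈ 𝔫 ^ k, f * g ∈ J ^ n) ↔
      f ∈ Ideal.map (Polynomial.C :
        MvPolynomial (Fin r) K →+* Polynomial (MvPolynomial (Fin r) K)) (𝔪 ^ n) := by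
  have hM : Ideal.map (Polynomial.C :
      MvPolynomial (Fin r) K →+* Polynomial (MvPolynomial (Fin r) K)) 𝔪 =
      Ideal.span (Set.range fun i : Fin r =>
        Polynomial.C (X i : MvPolynomial (Fin r) K)) := by
    rw [h𝔪, Ideal.map_span, ← Set.range_comp]
    rfl
  have hJ' : J = Ideal.map (Polynomial.C :
      MvPolynomial (Fin r) K →+* Polynomial (MvPolynomial (Fin r) K)) 𝔪 * 𝔫 := by
    rw [hJ, h𝔫, Ideal.span_union, ← hM, Ideal.mul_sup, Ideal.map_pow, pow_two]
    congr 1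
    rw [hM, Ideal.span_mul_span', Set.mul_singleton, ← Set.range_comp]
    rfl
  have hX : (Polynomial.X : Polynomial (MvPolynomial (Fin r) K)) ∈ 𝔫 := by
    rw [h𝔫]
    exact Ideal.subset_span (Or.inr rfl)
  have hJn : J ^ n = Ideal.map (Polynomial.C :
      MvPolynomial (Fin r) K →+* Polynomial (MvPolynomial (Fin r) K)) (𝔪 ^ n) * 𝔫 ^ n := by
    rw [hJ', Ideal.map_pow]
    exact mul_pow (M := Ideal (Polynomial (MvPolynomial (Fin r) K))) _ _ n
  rw [hJn]
  constructor
  · rintro ⟨k, -, hk⟩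
    have h := Ideal.mul_le_left (hk _ (Ideal.pow_mem_pow hX k))
    rw [Ideal.mem_map_C_iff] at h ⊢
    intro i
    simpa only [Polynomial.coeff_mul_X_pow] using h (i + k)
  · exact fun hf => ⟨n, hn, fun g hg => Ideal.mul_mem_mul hf hg⟩
end

section
/- Let K be a field, S = K[x_1,…,x_r], R = S[y], and let L be any ideal of S. Then for every n ≥ 1, every t with 0 ≤ t ≤ n, and every g ∈ S: the element g·y^t belongs to (LR + yR)^n if and only if g ∈ L^{n−t}. -/
open MvPolynomial Polynomial

theorem coeff_mem_of_mem_map_C_sup_span_X {S : Type*} [CommRing S] (L : Ideal S)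
    {p : Polynomial S}
    (hp : p ∈ Ideal.map (Polynomial.C : S →+* Polynomial S) L ⊔
      Ideal.span {(Polynomial.X : Polynomial S)}) (k : ℕ) :
    p.coeff k ∈ L ^ (1 - k) := by
  rcases k with _ | k
  · have hle : Ideal.map (Polynomial.C : S →+* Polynomial S) L ⊔
        Ideal.span {(Polynomial.X : Polynomial S)} ≤
          Ideal.comap (Polynomial.constantCoeff : Polynomial S →+* S) L := by
      refine sup_le (Ideal.map_le_iff_le_comap.2 fun x hx => ?_) ?_
      · simpa [Ideal.mem_comap] using hx
      · rw [Ideal.span_singleton_le_iff_mem]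
        simp [Ideal.mem_comap]
    simpa [Ideal.mem_comap] using hle hp
  · simp

theorem coeff_mem_pow_of_mem_map_C_sup_span_X_pow {S : Type*} [CommRing S] (L : Ideal S) (n : ℕ)
    {p : Polynomial S}
    (hp : p ∈ (Ideal.map (Polynomial.C : S →+* Polynomial S) L ⊔
      Ideal.span {(Polynomial.X : Polynomial S)}) ^ n) (k : ℕ) :
    p.coeff k ∈ L ^ (n - k) := by
  induction n generalizing p k with
  | zero => simp
  | succ n ih =>
    rw [pow_succ] at hp
    induction hp using Submodule.mul_induction_on' with
    | mem_mul_mem a ha b hb =>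
      rw [Polynomial.coeff_mul]
      refine Ideal.sum_mem _ fun ij hij => ?_
      have hk := Finset.HasAntidiagonal.mem_antidiagonal.1 hij
      have hab := Ideal.mul_mem_mul (ih ha ij.1) (coeff_mem_of_mem_map_C_sup_span_X L hb ij.2)
      rw [← pow_add] at hab
      exact Ideal.pow_le_pow_right (by omega) hab
    | add a _ b _ ha hb =>
      rw [Polynomial.coeff_add]
      exact Ideal.add_mem _ ha hb

theorem C_mul_X_pow_mem_map_C_sup_span_X_pow {S : Type*} [CommRing S] (L : Ideal S) {n t : ℕ}
    (ht : t ≤ n) {g : S} (hg : g ∈ L ^ (n - t)) :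
    Polynomial.C g * Polynomial.X ^ t ∈ (Ideal.map (Polynomial.C : S →+* Polynomial S) L ⊔
      Ideal.span {(Polynomial.X : Polynomial S)}) ^ n := by
  rw [← Nat.sub_add_cancel ht, pow_add]
  refine Ideal.mul_mem_mul ?_ (Ideal.pow_mem_pow ?_ t)
  · refine Ideal.pow_right_mono le_sup_left _ ?_
    rw [← Ideal.map_pow]
    exact Ideal.mem_map_of_mem _ hg
  · exact Ideal.mem_sup_right (Ideal.mem_span_singleton_self _)

theorem stmt_5 {K : Type*} [Field K] {r : ℕ}
    (L : Ideal (MvPolynomial (Fin r) K))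
    (n : ℕ) (hn : 1 ≤ n) (t : ℕ) (ht : t ≤ n) (g : MvPolynomial (Fin r) K) :
    Polynomial.C g * Polynomial.X ^ t ∈
        (Ideal.map (Polynomial.C :
          MvPolynomial (Fin r) K →+* Polynomial (MvPolynomial (Fin r) K)) L ⊔
         Ideal.span {(Polynomial.X : Polynomial (MvPolynomial (Fin r) K))}) ^ n ↔
      g ∈ L ^ (n - t) := by
  constructor
  · intro h
    simpa using coeff_mem_pow_of_mem_map_C_sup_span_X_pow L n h t
  · exact C_mul_X_pow_mem_map_C_sup_span_X_pow L ht
end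

section
/- Let G be a finite simple graph on [r] = {1,…,r} and let p be a vertex of G of degree ≥ 2. Then the monomial localization of the Stanley–Reisner ideal I_G at {p} satisfies I_G[{p}]S = (x_i x_j : i ≠ j, i,j ∈ N_p) + (x_i : i ∈ M_p), where N_p is the set of neighbors of p in G and M_p = [r]∖(N_p ∪ {p}). -/
open MvPolynomial

/-- The Stanley–Reisner ideal of a graph viewed as a one-dimensional simplicial complex. -/
noncomputable def SRIdeal (K : Type*) [Field K] {r : ℕ} (G : SimpleGraph (Fin r)) :
    Ideal (MvPolynomial (Fin r) K) :=
  Ideal.span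
    ({p | ∃ i j : Fin r, i ≠ j ∧ ¬ G.Adj i j ∧ p = X i * X j} ∪
     {p | ∃ i j k : Fin r, i ≠ j ∧ i ≠ k ∧ j ≠ k ∧ p = X i * X j * X k})

/-- Monomial localization `I_G[F]S`. -/
noncomputable def locSR (K : Type*) [Field K] {r : ℕ} (G : SimpleGraph (Fin r))
    (F : Finset (Fin r)) : Ideal (MvPolynomial (Fin r) K) :=
  Ideal.map (aeval (fun i : Fin r => if i ∈ F then 1 else X i) :
      MvPolynomial (Fin r) K →ₐ[K] MvPolynomial (Fin r) K) (SRIdeal K G)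

/-- A product of two distinct variables other than `X p` lies in the ideal generated by the products
of distinct neighbors of `p` and by the non-neighbors of `p`. -/
theorem X_mul_X_mem_span_neighborSet (K : Type*) [Field K] {r : ℕ} (G : SimpleGraph (Fin r))
    {p i j : Fin r} (hij : i ≠ j) (hi : i ≠ p) (hj : j ≠ p) :
    (X i * X j : MvPolynomial (Fin r) K) ∈
      Ideal.span
        ({m | ∃ i j : Fin r, i ≠ j ∧ i ∈ G.neighborSet p ∧ j ∈ G.neighborSet p ∧
            m = X i * X j} ∪
         (fun i : Fin r => (X i : MvPolynomial (Fin r) K)) ''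
            {i : Fin r | i ∉ G.neighborSet p ∧ i ≠ p}) := by
  by_cases hiN : i ∈ G.neighborSet p
  · by_cases hjN : j ∈ G.neighborSet p
    · exact Ideal.subset_span (Or.inl ⟨i, j, hij, hiN, hjN, rfl⟩)
    · exact Ideal.mul_mem_left _ _ (Ideal.subset_span (Or.inr ⟨j, ⟨hjN, hj⟩, rfl⟩))
  · exact Ideal.mul_mem_right _ _ (Ideal.subset_span (Or.inr ⟨i, ⟨hiN, hi⟩, rfl⟩))

theorem stmt_7 (K : Type*) [Field K] {r : ℕ} (G : SimpleGraph (Fin r))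
    [DecidableRel G.Adj] (p : Fin r) (hp : 2 ≤ G.degree p) :
    locSR K G {p} =
      Ideal.span
        ({m | ∃ i j : Fin r, i ≠ j ∧ i ∈ G.neighborSet p ∧ j ∈ G.neighborSet p ∧
            m = X i * X j} ∪
         (fun i : Fin r => (X i : MvPolynomial (Fin r) K)) ''
            {i : Fin r | i ∉ G.neighborSet p ∧ i ≠ p}) := by
  apply le_antisymm
  · rw [locSR, SRIdeal, Ideal.map_le_iff_le_comap, Ideal.span_le]
    rintro _ (⟨i, j, hij, hadj, rfl⟩ | ⟨i, j, k, hij, hik, hjk, rfl⟩)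
    · simp only [SetLike.mem_coe, Ideal.mem_comap, map_mul, aeval_X, Finset.mem_singleton]
      by_cases hi : i = p
      · subst hi
        rw [if_pos rfl, if_neg hij.symm, one_mul]
        exact Ideal.subset_span (Or.inr ⟨j, ⟨hadj, hij.symm⟩, rfl⟩)
      by_cases hj : j = p
      · subst hj
        rw [if_pos rfl, if_neg hi, mul_one]
        exact Ideal.subset_span (Or.inr ⟨i, ⟨fun h => hadj (G.adj_symm h), hi⟩, rfl⟩)
      rw [if_neg hi, if_neg hj]
      exact X_mul_X_mem_span_neighborSet K G hij hi hj
    · simp only [SetLike.mem_coe, Ideal.mem_comap, map_mul, aeval_X, Finset.mem_singleton]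
      by_cases hi : i = p
      · subst hi
        rw [if_pos rfl, if_neg hij.symm, if_neg hik.symm, one_mul]
        exact X_mul_X_mem_span_neighborSet K G hjk hij.symm hik.symm
      by_cases hj : j = p
      · subst hj
        rw [if_pos rfl, if_neg hi, if_neg hjk.symm, mul_one]
        exact X_mul_X_mem_span_neighborSet K G hik hi hjk.symm
      rw [if_neg hi, if_neg hj]
      exact Ideal.mul_mem_right _ _ (X_mul_X_mem_span_neighborSet K G hij hi hj)
  · rw [Ideal.span_le]
    rintro _ (⟨i, j, hij, hi, hj, rfl⟩ | ⟨i, ⟨hiN, hi⟩, rfl⟩)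
    · have hip : i ≠ p := (G.ne_of_adj hi).symm
      have hjp : j ≠ p := (G.ne_of_adj hj).symm
      have h : (X p * X i * X j : MvPolynomial (Fin r) K) ∈ SRIdeal K G :=
        Ideal.subset_span (Or.inr ⟨p, i, j, hip.symm, hjp.symm, hij, rfl⟩)
      simpa [locSR, hip, hjp] using Ideal.mem_map_of_mem
        (aeval (fun i : Fin r => if i ∈ ({p} : Finset (Fin r)) then 1 else X i) :
          MvPolynomial (Fin r) K →ₐ[K] MvPolynomial (Fin r) K) h
    · have h : (X p * X i : MvPolynomial (Fin r) K) ∈ SRIdeal K G :=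
        Ideal.subset_span (Or.inl ⟨p, i, hi.symm, hiN, rfl⟩)
      simpa [locSR, hi] using Ideal.mem_map_of_mem
        (aeval (fun i : Fin r => if i ∈ ({p} : Finset (Fin r)) then 1 else X i) :
          MvPolynomial (Fin r) K →ₐ[K] MvPolynomial (Fin r) K) h
end

section
/- Let G be a finite simple graph on [r] = {1,…,r}, let p ≠ q be vertices, let a = (a_1,…,a_r) ∈ ℕ^r, and fix n ≥ 1. Then x^a ∉ (I_G[{p,q}]S)^n if and only if {p,q} is an edge of G and Σ_{i ∈ [r]∖{p,q}} a_i ≤ n − 1. -/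
open MvPolynomial

/-- If `p` and `q` are not adjacent, localizing at `{p, q}` gives the unit ideal. -/
theorem locSR_pair_eq_top (K : Type*) [Field K] {r : ℕ} (G : SimpleGraph (Fin r))
    {p q : Fin r} (hpq : p ≠ q) (h : ¬ G.Adj p q) : locSR K G {p, q} = ⊤ := by
  rw [Ideal.eq_top_iff_one]
  have hmem : (X p * X q : MvPolynomial (Fin r) K) ∈ SRIdeal K G :=
    Ideal.subset_span (Or.inl ⟨p, q, hpq, h, rfl⟩)
  simpa [locSR] using Ideal.mem_map_of_mem (aeval (fun i : Fin r =>
    if i ∈ ({p, q} : Finset (Fin r)) then 1 else X i) :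
      MvPolynomial (Fin r) K →ₐ[K] MvPolynomial (Fin r) K) hmem

/-- Every variable other than `x_p` and `x_q` lies in the localization at `{p, q}`. -/
theorem X_mem_locSR_pair (K : Type*) [Field K] {r : ℕ} (G : SimpleGraph (Fin r))
    {p q k : Fin r} (hpq : p ≠ q) (hkp : k ≠ p) (hkq : k ≠ q) :
    (X k : MvPolynomial (Fin r) K) ∈ locSR K G {p, q} := by
  have hmem : (X p * X q * X k : MvPolynomial (Fin r) K) ∈ SRIdeal K G :=
    Ideal.subset_span (Or.inr ⟨p, q, k, hpq, hkp.symm, hkq.symm, rfl⟩)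
  simpa [locSR, hkp, hkq] using Ideal.mem_map_of_mem (aeval (fun i : Fin r =>
    if i ∈ ({p, q} : Finset (Fin r)) then 1 else X i) :
      MvPolynomial (Fin r) K →ₐ[K] MvPolynomial (Fin r) K) hmem

/-- The specialization `x_p, x_q ↦ 1` and `x_k ↦ t` for all other variables. -/
noncomputable def pairSpecialization (K : Type*) [Field K] {r : ℕ} (p q : Fin r) :
    MvPolynomial (Fin r) K →ₐ[K] Polynomial K :=
  aeval (fun i : Fin r => if i = p ∨ i = q then 1 else Polynomial.X)

/-- If `{p, q}` is an edge, the specialization sends the localization at `{p, q}` into `(t)`. -/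
theorem map_locSR_pair_le (K : Type*) [Field K] {r : ℕ} (G : SimpleGraph (Fin r))
    {p q : Fin r} (h : G.Adj p q) :
    (locSR K G {p, q}).map (pairSpecialization K p q) ≤ Ideal.span {Polynomial.X} := by
  rw [Ideal.map_le_iff_le_comap, locSR, Ideal.map_le_iff_le_comap, SRIdeal, Ideal.span_le]
  rintro _ (⟨i, j, hij, hadj, rfl⟩ | ⟨i, j, k, hij, hik, hjk, rfl⟩)
  · have hout : (i ≠ p ∧ i ≠ q) ∨ (j ≠ p ∧ j ≠ q) := by
      have := h.symm
      grind
    simp only [SetLike.mem_coe, Ideal.mem_comap, Ideal.mem_span_singleton, map_mul]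
    rcases hout with ⟨h1, h2⟩ | ⟨h1, h2⟩
    · exact Dvd.dvd.mul_right (by simp [pairSpecialization, h1, h2]) _
    · exact Dvd.dvd.mul_left (by simp [pairSpecialization, h1, h2]) _
  · have hout : (i ≠ p ∧ i ≠ q) ∨ (j ≠ p ∧ j ≠ q) ∨ (k ≠ p ∧ k ≠ q) := by grind
    simp only [SetLike.mem_coe, Ideal.mem_comap, Ideal.mem_span_singleton, map_mul]
    rcases hout with ⟨h1, h2⟩ | ⟨h1, h2⟩ | ⟨h1, h2⟩
    · exact Dvd.dvd.mul_right (Dvd.dvd.mul_right (by simp [pairSpecialization, h1, h2]) _) _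
    · exact Dvd.dvd.mul_right (Dvd.dvd.mul_left (by simp [pairSpecialization, h1, h2]) _) _
    · exact Dvd.dvd.mul_left (by simp [pairSpecialization, h1, h2]) _

theorem pairSpecialization_monomial (K : Type*) [Field K] {r : ℕ} (p q : Fin r)
    (a : Fin r → ℕ) :
    pairSpecialization K p q (∏ i, X i ^ a i) =
      Polynomial.X ^ ∑ i ∈ Finset.univ.filter (fun i : Fin r => i ≠ p ∧ i ≠ q), a i := by
  rw [map_prod, ← Finset.prod_pow_eq_pow_sum, Finset.prod_filter]
  refine Finset.prod_congr rfl fun i _ => ?_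
  by_cases hi : i = p ∨ i = q
  · have : ¬ (i ≠ p ∧ i ≠ q) := by tauto
    simp [pairSpecialization, hi, this]
  · have : i ≠ p ∧ i ≠ q := by tauto
    simp [pairSpecialization, this]

theorem monomial_mem_locSR_pair_pow (K : Type*) [Field K] {r : ℕ} (G : SimpleGraph (Fin r))
    {p q : Fin r} (hpq : p ≠ q) (a : Fin r → ℕ) :
    (∏ i, (X i : MvPolynomial (Fin r) K) ^ a i) ∈ (locSR K G {p, q}) ^
      ∑ i ∈ Finset.univ.filter (fun i : Fin r => i ≠ p ∧ i ≠ q), a i := by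
  rw [← Finset.prod_filter_mul_prod_filter_not Finset.univ (fun i : Fin r => i ≠ p ∧ i ≠ q),
    ← Finset.prod_pow_eq_pow_sum]
  refine Ideal.mul_mem_right _ _ (Ideal.prod_mem_prod fun i hi => ?_)
  obtain ⟨hip, hiq⟩ := (Finset.mem_filter.mp hi).2
  exact Ideal.pow_mem_pow (X_mem_locSR_pair K G hpq hip hiq) _

theorem stmt_8 (K : Type*) [Field K] {r : ℕ} (G : SimpleGraph (Fin r))
    (p q : Fin r) (hpq : p ≠ q) (a : Fin r → ℕ) (n : ℕ) (hn : 1 ≤ n) :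
    (∏ i, (X i : MvPolynomial (Fin r) K) ^ a i) ∉ (locSR K G {p, q}) ^ n ↔
      G.Adj p q ∧
        (∑ i ∈ Finset.univ.filter (fun i : Fin r => i ≠ p ∧ i ≠ q), a i) ≤ n - 1 := by
  constructor
  · intro hmem
    refine ⟨?_, ?_⟩
    · by_contra h
      exact hmem (by simp [locSR_pair_eq_top K G hpq h, Ideal.top_pow])
    · by_contra! hlt
      exact hmem (Ideal.pow_le_pow_right (by omega) (monomial_mem_locSR_pair_pow K G hpq a))
  · rintro ⟨hadj, hle⟩ hmem
    have himage := Ideal.mem_map_of_mem (pairSpecialization K p q) hmem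
    rw [Ideal.map_pow, pairSpecialization_monomial] at himage
    have hdvd := Ideal.pow_right_mono (map_locSR_pair_le K G hadj) n himage
    rw [Ideal.span_singleton_pow, Ideal.mem_span_singleton,
      pow_dvd_pow_iff Polynomial.X_ne_zero Polynomial.not_isUnit_X] at hdvd
    omega
end

section
/- Let G be a finite simple graph on [r] = {1,…,r}, let p be a vertex of degree ≥ 2, let a = (a_1,…,a_r) ∈ ℕ^r, and fix n ≥ 1. Then the following are equivalent: (1) p is an isolated vertex of Δ_a(I_G^n), i.e., x^a ∉ (I_G[{p}]S)^n and x^a ∈ (I_G[{p,j}]S)^n for every j ≠ p; (2) there exists t ∈ {0,1,…,n−1} such that Σ_{i ∈ M_p} a_i = t, and Σ_{i ∈ N_p∖{j}} a_i ≥ n − t for all j ∈ N_p, and Σ_{i ∈ N_p} a_i ≤ 2(n − t) − 1. -/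
open MvPolynomial

/-- If `J` contains all products `x i * x j` of distinct members of a family, then a monomial in the
family whose exponent vector admits `m` disjoint pairs of distinct indices lies in `J ^ m`. -/
lemma Ideal.prod_pow_mem_pow_of_mul_mem {R ι : Type*} [CommRing R] [DecidableEq ι] (J : Ideal R)
    (x : ι → R) (s : Finset ι) (hJ : ∀ i ∈ s, ∀ j ∈ s, i ≠ j → x i * x j ∈ J) (m : ℕ) (a : ι → ℕ)
    (hsum : 2 * m ≤ ∑ i ∈ s, a i) (hmax : ∀ j ∈ s, m + a j ≤ ∑ i ∈ s, a i) :
    ∏ i ∈ s, x i ^ a i ∈ J ^ m := by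
  induction m generalizing a with
  | zero => simp
  | succ m ih =>
    have hs : s.Nonempty := by
      by_contra h
      rw [Finset.not_nonempty_iff_eq_empty] at h
      simp [h] at hsum
    obtain ⟨i, hi, hi_max⟩ := s.exists_max_image a hs
    have hsplit := Finset.add_sum_erase s a hi
    have hi_le := hmax i hi
    have hs' : (s.erase i).Nonempty := by
      by_contra h
      rw [Finset.not_nonempty_iff_eq_empty] at h
      simp only [h, Finset.sum_empty] at hsplit
      omega
    obtain ⟨j, hj, hj_max⟩ := (s.erase i).exists_max_image a hs'
    obtain ⟨hji, hjs⟩ := Finset.mem_erase.1 hj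
    have hj_pos : 1 ≤ a j := by
      by_contra h
      have : ∑ k ∈ s.erase i, a k = 0 := Finset.sum_eq_zero fun k hk => by
        have := hj_max k hk
        omega
      omega
    have hij := hi_max j hjs
    obtain ⟨b, hb⟩ : ∃ b : ι → ℕ, ∀ k,
        a k = b k + (if k = i then 1 else 0) + (if k = j then 1 else 0) := by
      refine ⟨fun k => a k - (if k = i then 1 else 0) - (if k = j then 1 else 0), fun k => ?_⟩
      by_cases h₁ : k = i
      · subst h₁
        simp only [if_true, if_neg hji.symm]
        omega
      · by_cases h₂ : k = j
        · subst h₂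
          simp only [if_true, if_neg hji]
          omega
        · simp [h₁, h₂]
    have hsum_b : ∑ k ∈ s, a k = ∑ k ∈ s, b k + 1 + 1 := by
      simp [hb, Finset.sum_add_distrib, hi, hjs]
    have hprod : ∏ k ∈ s, x k ^ a k = (∏ k ∈ s, x k ^ b k) * (x i * x j) := by
      simp_rw [hb, pow_add, Finset.prod_mul_distrib, pow_ite, pow_one, pow_zero]
      rw [Finset.prod_ite_eq' s i, Finset.prod_ite_eq' s j, if_pos hi, if_pos hjs, mul_assoc]
    rw [hprod, pow_succ]
    refine Ideal.mul_mem_mul (ih b (by omega) fun k hk => ?_) (hJ i hi j hjs hji.symm)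
    have hk_le := hmax k hk
    have hbk := hb k
    by_cases h₁ : k = i
    · rw [if_pos h₁] at hbk
      omega
    by_cases h₂ : k = j
    · rw [if_pos h₂] at hbk
      omega
    have hkj := hj_max k (Finset.mem_erase.2 ⟨h₁, hk⟩)
    have hthree : a i + (a j + a k) ≤ ∑ l ∈ s, a l := by
      have hsub : ({i, j, k} : Finset ι) ⊆ s := by
        simp [Finset.insert_subset_iff, hi, hjs, hk]
      have := Finset.sum_le_sum_of_subset (f := a) hsub
      rwa [Finset.sum_insert (by simp [hji.symm, Ne.symm h₁]),
        Finset.sum_insert (by simp [Ne.symm h₂]), Finset.sum_singleton] at this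
    simp only [h₁, h₂, if_false] at hbk
    omega

lemma Ideal.prod_pow_mem_pow_sum {R ι : Type*} [CommRing R] (J : Ideal R) (x : ι → R)
    (s : Finset ι) (hJ : ∀ i ∈ s, x i ∈ J) (a : ι → ℕ) :
    ∏ i ∈ s, x i ^ a i ∈ J ^ ∑ i ∈ s, a i := by
  rw [← Finset.prod_pow_eq_pow_sum]
  exact Ideal.prod_mem_prod fun i hi => Ideal.pow_mem_pow (hJ i hi) _

section locSR

variable {K : Type*} [Field K] {r : ℕ} {G : SimpleGraph (Fin r)} {F : Finset (Fin r)}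

lemma mul_mem_locSR {i j : Fin r} (hij : i ≠ j) (hadj : ¬ G.Adj i j) :
    (if i ∈ F then 1 else X i) * (if j ∈ F then 1 else X j) ∈ locSR K G F := by
  have h : (X i * X j : MvPolynomial (Fin r) K) ∈ SRIdeal K G :=
    Ideal.subset_span (Or.inl ⟨i, j, hij, hadj, rfl⟩)
  simpa [locSR] using Ideal.mem_map_of_mem (aeval (fun i : Fin r => if i ∈ F then 1 else X i) :
    MvPolynomial (Fin r) K →ₐ[K] MvPolynomial (Fin r) K) h

lemma mul_mul_mem_locSR {i j k : Fin r} (hij : i ≠ j) (hik : i ≠ k) (hjk : j ≠ k) :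
    (if i ∈ F then 1 else X i) * (if j ∈ F then 1 else X j) * (if k ∈ F then 1 else X k) ∈
      locSR K G F := by
  have h : (X i * X j * X k : MvPolynomial (Fin r) K) ∈ SRIdeal K G :=
    Ideal.subset_span (Or.inr ⟨i, j, k, hij, hik, hjk, rfl⟩)
  simpa [locSR] using Ideal.mem_map_of_mem (aeval (fun i : Fin r => if i ∈ F then 1 else X i) :
    MvPolynomial (Fin r) K →ₐ[K] MvPolynomial (Fin r) K) h

/-- If a weight vanishing on `F` is at least `d` on every generator of `SRIdeal K G`, then monomials
in `locSR K G F ^ n` have weight at least `d * n`. -/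
lemma le_weight_of_mem_locSR_pow (w : Fin r → ℕ) (d : ℕ) (hF : ∀ i ∈ F, w i = 0)
    (hpair : ∀ i j, i ≠ j → ¬ G.Adj i j → d ≤ w i + w j)
    (htriple : ∀ i j k, i ≠ j → i ≠ k → j ≠ k → d ≤ w i + w j + w k) {a : Fin r → ℕ} {n : ℕ}
    (h : ∏ i, (X i : MvPolynomial (Fin r) K) ^ a i ∈ locSR K G F ^ n) :
    d * n ≤ ∑ i, w i * a i := by
  let φ : MvPolynomial (Fin r) K →ₐ[K] Polynomial K := aeval fun i => Polynomial.X ^ w i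
  have hle : (locSR K G F).map φ ≤ Ideal.span {(Polynomial.X : Polynomial K) ^ d} := by
    have hX : ∀ i, φ (if i ∈ F then 1 else X i) = Polynomial.X ^ w i := by
      intro i
      by_cases hi : i ∈ F
      · simp [hi, hF i hi]
      · simp [hi, φ]
    rw [Ideal.map_le_iff_le_comap, locSR, Ideal.map_le_iff_le_comap, SRIdeal, Ideal.span_le]
    rintro q (⟨i, j, hij, hadj, rfl⟩ | ⟨i, j, k, hij, hik, hjk, rfl⟩)
    · simp only [SetLike.mem_coe, Ideal.mem_comap, map_mul, aeval_X, hX,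
        Ideal.mem_span_singleton, ← pow_add]
      exact pow_dvd_pow _ (hpair i j hij hadj)
    · simp only [SetLike.mem_coe, Ideal.mem_comap, map_mul, aeval_X, hX,
        Ideal.mem_span_singleton, ← pow_add]
      exact pow_dvd_pow _ (htriple i j k hij hik hjk)
  have hmem := Ideal.mem_map_of_mem φ h
  rw [Ideal.map_pow] at hmem
  replace hmem := Ideal.pow_right_mono hle n hmem
  rw [Ideal.span_singleton_pow, Ideal.mem_span_singleton, ← pow_mul] at hmem
  simp only [map_prod, map_pow, φ, aeval_X, ← pow_mul, Finset.prod_pow_eq_pow_sum] at hmem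
  exact (pow_dvd_pow_iff Polynomial.X_ne_zero Polynomial.not_isUnit_X).1 hmem

lemma X_mem_locSR_singleton {p i : Fin r} (hip : i ≠ p) (hadj : ¬ G.Adj p i) :
    (X i : MvPolynomial (Fin r) K) ∈ locSR K G {p} := by
  simpa [hip] using mul_mem_locSR (K := K) (F := {p}) hip.symm hadj

lemma X_mul_X_mem_locSR_singleton {p i j : Fin r} (hip : i ≠ p) (hjp : j ≠ p) (hij : i ≠ j) :
    (X i * X j : MvPolynomial (Fin r) K) ∈ locSR K G {p} := by
  simpa [hip, hjp] using
    mul_mul_mem_locSR (K := K) (G := G) (F := {p}) hip.symm hjp.symm hij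

lemma X_mem_locSR_pair_s9 {p j i : Fin r} (hjp : j ≠ p) (hip : i ≠ p) (hij : i ≠ j) :
    (X i : MvPolynomial (Fin r) K) ∈ locSR K G {p, j} := by
  simpa [hij, hip] using
    mul_mul_mem_locSR (K := K) (G := G) (F := {p, j}) hjp.symm hip.symm hij.symm

lemma locSR_pair_eq_top_s9 {p j : Fin r} (hjp : j ≠ p) (hadj : ¬ G.Adj p j) :
    locSR K G {p, j} = ⊤ := by
  have h := mul_mem_locSR (K := K) (F := {p, j}) hjp.symm hadj
  exact (Ideal.eq_top_iff_one _).2 (by simpa using h)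

lemma le_sum_of_mem_locSR_pair_pow {p j : Fin r} (hpj : G.Adj p j) {a : Fin r → ℕ} {n : ℕ}
    (h : ∏ i, (X i : MvPolynomial (Fin r) K) ^ a i ∈ locSR K G {p, j} ^ n) :
    n ≤ ∑ i, (if i = p ∨ i = j then 0 else 1) * a i := by
  refine one_mul n ▸ le_weight_of_mem_locSR_pow (fun i => if i = p ∨ i = j then 0 else 1) 1
    (by simp) (fun i k hik hadj => ?_) (fun i k l hik hil hkl => ?_) h
  · have := hpj.symm
    grind
  · grind

lemma two_mul_le_sum_of_mem_locSR_singleton_pow [DecidableRel G.Adj] {p : Fin r}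
    {a : Fin r → ℕ} {n : ℕ}
    (h : ∏ i, (X i : MvPolynomial (Fin r) K) ^ a i ∈ locSR K G {p} ^ n) :
    2 * n ≤ ∑ i, (if i = p then 0 else if G.Adj p i then 1 else 2) * a i := by
  refine le_weight_of_mem_locSR_pow (fun i => if i = p then 0 else if G.Adj p i then 1 else 2) 2
    (by simp) (fun i k hik hadj => ?_) (fun i k l hik hil hkl => ?_) h
  · have := G.adj_comm i k
    grind
  · grind

end locSR

theorem stmt_9 (K : Type*) [Field K] {r : ℕ} (G : SimpleGraph (Fin r))
    [DecidableRel G.Adj] (p : Fin r) (hp : 2 ≤ G.degree p)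
    (a : Fin r → ℕ) (n : ℕ) (hn : 1 ≤ n) :
    ((∏ i, (X i : MvPolynomial (Fin r) K) ^ a i) ∉ (locSR K G {p}) ^ n ∧
      ∀ j : Fin r, j ≠ p →
        (∏ i, (X i : MvPolynomial (Fin r) K) ^ a i) ∈ (locSR K G {p, j}) ^ n) ↔
    (∃ t ∈ Finset.range n,
      (∑ i ∈ Finset.univ.filter
          (fun i : Fin r => i ∉ G.neighborFinset p ∧ i ≠ p), a i) = t ∧
      (∀ j ∈ G.neighborFinset p,
        n - t ≤ ∑ i ∈ (G.neighborFinset p).filter (fun i => i ≠ j), a i) ∧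
      (∑ i ∈ G.neighborFinset p, a i) ≤ 2 * (n - t) - 1) := by
  classical
  set N := G.neighborFinset p with hN
  set M := Finset.univ.filter (fun i : Fin r => i ∉ N ∧ i ≠ p) with hM
  have hpN : p ∉ N := by simp [hN]
  have hNp : ∀ i ∈ N, i ≠ p := fun i hi h => hpN (h ▸ hi)
  have hdisj : Disjoint N M := by
    rw [Finset.disjoint_left]
    intro i hi h
    exact (Finset.mem_filter.1 h).2.1 hi
  have huniv : (Finset.univ : Finset (Fin r)) = insert p (N ∪ M) := by
    ext i
    simp [hM]
    tauto
  have hpNM : p ∉ N ∪ M := by simp [hpN, hM]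
  have hsum : ∀ f : Fin r → ℕ, ∑ i, f i = f p + (∑ i ∈ N, f i + ∑ i ∈ M, f i) := fun f => by
    rw [huniv, Finset.sum_insert hpNM, Finset.sum_union hdisj]
  have hprod : ∏ i, (X i : MvPolynomial (Fin r) K) ^ a i =
      X p ^ a p * ((∏ i ∈ N, X i ^ a i) * ∏ i ∈ M, X i ^ a i) := by
    rw [huniv, Finset.prod_insert hpNM, Finset.prod_union hdisj]
  have hXM : ∀ i ∈ M, (X i : MvPolynomial (Fin r) K) ∈ locSR K G {p} := by
    intro i hi
    obtain ⟨-, hiN, hip⟩ := Finset.mem_filter.1 hi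
    have hadj : ¬ G.Adj p i := by simpa [hN] using hiN
    exact X_mem_locSR_singleton hip hadj
  have hXN : ∀ i ∈ N, ∀ j ∈ N, i ≠ j →
      (X i * X j : MvPolynomial (Fin r) K) ∈ locSR K G {p} := by
    intro i hi j hj hij
    exact X_mul_X_mem_locSR_singleton (hNp i hi) (hNp j hj) hij
  have hMmem := Ideal.prod_pow_mem_pow_sum (locSR K G {p}) X M hXM a
  have hfilter : ∀ j ∈ N, ∑ i ∈ N, a i = a j + ∑ i ∈ N.filter (fun i => i ≠ j), a i := by
    intro j hj
    rw [Finset.filter_ne', Finset.add_sum_erase N a hj]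
  constructor
  · rintro ⟨hnot, hmem⟩
    have hT : ∑ i ∈ M, a i < n := by
      by_contra! h
      apply hnot
      rw [hprod]
      exact Ideal.mul_mem_left _ _ (Ideal.mul_mem_left _ _ (Ideal.pow_le_pow_right h hMmem))
    have hlink : ∀ j ∈ N,
        n ≤ ∑ i ∈ M, a i + ∑ i ∈ N.filter (fun i => i ≠ j), a i := by
      intro j hj
      have h := le_sum_of_mem_locSR_pair_pow (by simpa [hN] using hj) (hmem j (hNp j hj))
      have hwN : ∑ i ∈ N, (if i = p ∨ i = j then 0 else 1) * a i =
          ∑ i ∈ N.filter (fun i => i ≠ j), a i := by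
        rw [Finset.sum_filter]
        refine Finset.sum_congr rfl fun i hi => ?_
        by_cases hij : i = j <;> simp [hij, hNp i hi]
      have hwM : ∑ i ∈ M, (if i = p ∨ i = j then 0 else 1) * a i = ∑ i ∈ M, a i :=
        Finset.sum_congr rfl fun i hi => by
          obtain ⟨-, hiN, hip⟩ := Finset.mem_filter.1 hi
          have hij : i ≠ j := fun h => hiN (h ▸ hj)
          simp [hip, hij]
      rw [hsum, hwN, hwM] at h
      simp only [true_or, if_true, zero_mul] at h
      omega
    refine ⟨_, Finset.mem_range.2 hT, rfl, fun j hj => ?_, ?_⟩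
    · have := hlink j hj
      omega
    · by_contra! h
      apply hnot
      rw [hprod]
      have hpairs := Ideal.prod_pow_mem_pow_of_mul_mem (locSR K G {p}) X N hXN
        (n - ∑ i ∈ M, a i) a (by omega) (fun j hj => by
          have := hlink j hj
          have := hfilter j hj
          omega)
      have hNM := Ideal.mul_mem_mul hpairs hMmem
      rw [← pow_add, Nat.sub_add_cancel hT.le] at hNM
      exact Ideal.mul_mem_left _ _ hNM
  · rintro ⟨t, ht, hMt, hlink, hN_le⟩
    rw [Finset.mem_range] at ht
    refine ⟨fun h => ?_, fun j hjp => ?_⟩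
    · have hw := two_mul_le_sum_of_mem_locSR_singleton_pow h
      have hwN : ∑ i ∈ N, (if i = p then 0 else if G.Adj p i then 1 else 2) * a i =
          ∑ i ∈ N, a i := Finset.sum_congr rfl fun i hi => by
        have : G.Adj p i := by simpa [hN] using hi
        simp [this, hNp i hi]
      have hwM : ∑ i ∈ M, (if i = p then 0 else if G.Adj p i then 1 else 2) * a i =
          2 * ∑ i ∈ M, a i := by
        rw [Finset.mul_sum]
        refine Finset.sum_congr rfl fun i hi => ?_
        obtain ⟨-, hiN, hip⟩ := Finset.mem_filter.1 hi
        have : ¬ G.Adj p i := by simpa [hN] using hiN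
        simp [this, hip]
      rw [hsum, hwN, hwM] at hw
      simp only [if_true, zero_mul] at hw
      omega
    · by_cases hj : j ∈ N
      · have hX : ∀ i ∈ N.filter (fun i => i ≠ j) ∪ M,
            (X i : MvPolynomial (Fin r) K) ∈ locSR K G {p, j} := by
          intro i hi
          have hij : i ≠ j := by
            rintro rfl
            simp [hM, hj] at hi
          have hip : i ≠ p := by
            rintro rfl
            simp [hM, hpN] at hi
          exact X_mem_locSR_pair_s9 hjp hip hij
        have hdisj' : Disjoint (N.filter (fun i => i ≠ j)) M :=
          hdisj.mono_left (Finset.filter_subset _ _)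
        have hmem := Ideal.prod_pow_mem_pow_sum (locSR K G {p, j}) X _ hX a
        rw [Finset.sum_union hdisj'] at hmem
        have hle := hlink j hj
        refine Ideal.mem_of_dvd _ ?_ (Ideal.pow_le_pow_right (by omega) hmem)
        exact Finset.prod_dvd_prod_of_subset _ _ _ (Finset.subset_univ _)
      · have hadj : ¬ G.Adj p j := by simpa [hN] using hj
        simp [locSR_pair_eq_top_s9 hjp hadj, ← Ideal.one_eq_top]
end

section
/- Let K be a field, S = K[x_1,…,x_r], N ⊆ [r] a subset, and J = (x_i x_j : i ≠ j, i,j ∈ N) the ideal of S generated by the products of two distinct variables indexed by N. Let k ≥ 1 and a = (a_1,…,a_r) ∈ ℕ^r. If Σ_{i ∈ N} a_i ≥ 2k and a_i ≤ k − 1 for every i ∈ N, then x^a ∈ J^k. -/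
open MvPolynomial

/-- If `x^a` has degree at least `2k` in the variables from `N`, and degree at least `k` in these
variables after removing any one of them, then `x^a` lies in `J^k` for every ideal `J` containing
the products of two distinct variables from `N`. -/
theorem prod_X_pow_mem_pow_of_le_sum {σ R : Type*} [Fintype σ] [CommSemiring R] (N : Finset σ)
    (J : Ideal (MvPolynomial σ R))
    (hJ : ∀ i ∈ N, ∀ j ∈ N, i ≠ j → (X i * X j : MvPolynomial σ R) ∈ J) (k : ℕ) (a : σ → ℕ)
    (hsum : 2 * k ≤ ∑ i ∈ N, a i) (hbd : ∀ i ∈ N, a i + k ≤ ∑ i ∈ N, a i) :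
    (∏ i, (X i : MvPolynomial σ R) ^ a i) ∈ J ^ k := by
  classical
  induction k generalizing a with
  | zero => simp
  | succ k ih =>
    have hN : N.Nonempty := by
      by_contra h
      simp [Finset.not_nonempty_iff_eq_empty.mp h] at hsum
    obtain ⟨i, hi, hmaxi⟩ := N.exists_max_image a hN
    have hadd := N.add_sum_erase a hi
    have hbdi := hbd i hi
    have hNi : (N.erase i).Nonempty := by
      by_contra h
      simp only [Finset.not_nonempty_iff_eq_empty.mp h, Finset.sum_empty] at hadd
      omega
    obtain ⟨j, hj', hmaxj⟩ := (N.erase i).exists_max_image a hNi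
    obtain ⟨hji, hj⟩ := Finset.mem_erase.mp hj'
    have hjpos : 0 < a j := by
      by_contra h
      have hzero : ∑ l ∈ N.erase i, a l = 0 :=
        Finset.sum_eq_zero fun l hl => by have := hmaxj l hl; omega
      omega
    have hipos : 0 < a i := hjpos.trans_le (hmaxi j hj)
    obtain ⟨b, hb⟩ : ∃ b : σ → ℕ,
        a = fun l => b l + ((if l = i then 1 else 0) + (if l = j then 1 else 0)) := by
      refine ⟨fun l => a l - ((if l = i then 1 else 0) + (if l = j then 1 else 0)), ?_⟩
      funext l
      grind
    have hsumb : ∑ l ∈ N, a l = ∑ l ∈ N, b l + 2 := by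
      simp [hb, Finset.sum_add_distrib, hi, hj]
    have hprod : (∏ l, (X l : MvPolynomial σ R) ^ a l) = (∏ l, X l ^ b l) * (X i * X j) := by
      simp only [hb, pow_add, Finset.prod_mul_distrib, pow_ite, pow_one, pow_zero,
        Finset.prod_ite_eq', Finset.mem_univ, if_true]
    rw [hprod, pow_succ]
    refine Ideal.mul_mem_mul (ih b (by omega) fun l hl => ?_) (hJ i hi j hj hji.symm)
    have hal := congrFun hb l
    have hbdl := hbd l hl
    by_cases hli : l = i
    · simp only [hli, if_true] at *
      omega
    by_cases hlj : l = j
    · simp only [hlj, if_true] at *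
      omega
    have hthree : a i + (a j + a l) ≤ ∑ l ∈ N, a l := by
      have hsub : ({i, j, l} : Finset σ) ⊆ N := by
        simp [Finset.insert_subset_iff, hi, hj, hl]
      have := Finset.sum_le_sum_of_subset (f := a) hsub
      rwa [Finset.sum_insert (by simp [Ne.symm hji, Ne.symm hli]),
        Finset.sum_insert (by simp [Ne.symm hlj]), Finset.sum_singleton] at this
    have hmaxil := hmaxi l hl
    have hmaxjl := hmaxj l (Finset.mem_erase.mpr ⟨hli, hl⟩)
    simp only [hli, hlj, if_false] at hal
    omega

theorem stmt_10 (K : Type*) [Field K] {r : ℕ} (N : Finset (Fin r))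
    (J : Ideal (MvPolynomial (Fin r) K))
    (hJ : J = Ideal.span
      {m | ∃ i j : Fin r, i ≠ j ∧ i ∈ N ∧ j ∈ N ∧ m = X i * X j})
    (k : ℕ) (hk : 1 ≤ k) (a : Fin r → ℕ)
    (hsum : 2 * k ≤ ∑ i ∈ N, a i) (hbd : ∀ i ∈ N, a i ≤ k - 1) :
    (∏ i, (X i : MvPolynomial (Fin r) K) ^ a i) ∈ J ^ k := by
  refine prod_X_pow_mem_pow_of_le_sum N J (fun i hi j hj hij => ?_) k a hsum fun i hi => ?_
  · rw [hJ]
    exact Ideal.subset_span ⟨i, j, hij, hi, hj, rfl⟩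
  · have := hbd i hi
    omega
end

section
/- Let G be a finite simple graph with diam(G) ≤ 2, i.e., any two distinct vertices are adjacent or have a common neighbor. Then G is not a matroid if and only if G has an induced subgraph isomorphic to the Broom or to the Pentagon. -/
/-- The Broom: vertices `{1,2,3,4}` (here `0,1,2,3`) with edges
`{1,2},{1,3},{2,3},{3,4}`. -/
def broom : SimpleGraph (Fin 4) :=
  SimpleGraph.fromRel (fun u v =>
    (u = 0 ∧ v = 1) ∨ (u = 0 ∧ v = 2) ∨ (u = 1 ∧ v = 2) ∨ (u = 2 ∧ v = 3))

/-- The Pentagon: the 5-cycle. -/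
def pentagon : SimpleGraph (Fin 5) :=
  SimpleGraph.fromRel (fun u v => v = u + 1)

/-- `G` has an induced subgraph isomorphic to `H`. -/
def HasInducedCopy {W V : Type*} (H : SimpleGraph W) (G : SimpleGraph V) : Prop :=
  ∃ f : W → V, Function.Injective f ∧ ∀ u v : W, G.Adj (f u) (f v) ↔ H.Adj u v

/-- `G`, viewed as a one-dimensional simplicial complex, is a matroid: equivalently, every
vertex outside an edge is adjacent to at least one endpoint of that edge. -/
def IsMatroidGraph {V : Type*} (G : SimpleGraph V) : Prop :=
  ∀ v a b : V, G.Adj a b → v ≠ a → v ≠ b → G.Adj v a ∨ G.Adj v b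

theorem HasInducedCopy.broom_of_adj {V : Type*} {G : SimpleGraph V} {a b c d : V}
    (hab : G.Adj a b) (hac : G.Adj a c) (hbc : G.Adj b c) (hcd : G.Adj c d)
    (had : ¬ G.Adj a d) (hbd : ¬ G.Adj b d) : HasInducedCopy broom G := by
  have hda : a ≠ d := fun h => hbd (h ▸ hab.symm)
  have hdb : b ≠ d := fun h => had (h ▸ hab)
  refine ⟨![a, b, c, d], fun u v => ?_, fun u v => ?_⟩
  · fin_cases u <;> fin_cases v <;>
      simp [hab.ne, hab.ne', hac.ne, hac.ne', hbc.ne, hbc.ne', hcd.ne, hcd.ne', hda, hda.symm,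
        hdb, hdb.symm]
  · fin_cases u <;> fin_cases v <;>
      simp [broom, hab, hab.symm, hac, hac.symm, hbc, hbc.symm, hcd, hcd.symm, had, hbd,
        G.adj_comm d a, G.adj_comm d b]

theorem HasInducedCopy.pentagon_of_adj {V : Type*} {G : SimpleGraph V} {a b c d e : V}
    (hab : G.Adj a b) (hbc : G.Adj b c) (hcd : G.Adj c d) (hde : G.Adj d e) (hea : G.Adj e a)
    (hac : ¬ G.Adj a c) (had : ¬ G.Adj a d) (hbd : ¬ G.Adj b d) (hbe : ¬ G.Adj b e)
    (hce : ¬ G.Adj c e) : HasInducedCopy pentagon G := by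
  have nac : a ≠ c := fun h => had (h ▸ hcd)
  have nad : a ≠ d := fun h => hac (h ▸ hcd.symm)
  have nbd : b ≠ d := fun h => hbe (h ▸ hde)
  have nbe : b ≠ e := fun h => hbd (h ▸ hde.symm)
  have nce : c ≠ e := fun h => hbe (h ▸ hbc)
  refine ⟨![a, b, c, d, e], fun u v => ?_, fun u v => ?_⟩
  · fin_cases u <;> fin_cases v <;>
      simp [hab.ne, hab.ne', hbc.ne, hbc.ne', hcd.ne, hcd.ne', hde.ne, hde.ne', hea.ne, hea.ne',
        nac, nac.symm, nad, nad.symm, nbd, nbd.symm, nbe, nbe.symm, nce, nce.symm]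
  · fin_cases u <;> fin_cases v <;>
      simp [pentagon, hab, hab.symm, hbc, hbc.symm, hcd, hcd.symm, hde, hde.symm, hea, hea.symm,
        hac, had, hbd, hbe, hce, G.adj_comm c a, G.adj_comm d a, G.adj_comm d b, G.adj_comm e b,
        G.adj_comm e c]

theorem IsMatroidGraph.of_hasInducedCopy {W V : Type*} {H : SimpleGraph W} {G : SimpleGraph V}
    (hG : IsMatroidGraph G) (h : HasInducedCopy H G) : IsMatroidGraph H := by
  obtain ⟨f, hf, hadj⟩ := h
  intro v a b hab hva hvb
  simpa only [hadj] using hG (f v) (f a) (f b) ((hadj a b).2 hab) (hf.ne hva) (hf.ne hvb)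

theorem not_isMatroidGraph_broom : ¬ IsMatroidGraph broom := fun h => by
  simpa [broom] using h 3 0 1

theorem not_isMatroidGraph_pentagon : ¬ IsMatroidGraph pentagon := fun h => by
  simpa [pentagon] using h 3 0 1

theorem stmt_13 {V : Type*} [Fintype V] (G : SimpleGraph V)
    (hdiam : ∀ u v : V, u ≠ v → G.Adj u v ∨ ∃ w : V, G.Adj u w ∧ G.Adj w v) :
    ¬ IsMatroidGraph G ↔ HasInducedCopy broom G ∨ HasInducedCopy pentagon G := by
  constructor
  · intro h
    simp only [IsMatroidGraph, not_forall, not_or] at h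
    obtain ⟨v, a, b, hab, hva, hvb, nva, nvb⟩ := h
    obtain ⟨x, hvx, hxa⟩ := (hdiam v a hva).resolve_left nva
    obtain ⟨y, hvy, hyb⟩ := (hdiam v b hvb).resolve_left nvb
    have nav : ¬ G.Adj a v := fun h => nva h.symm
    have nbv : ¬ G.Adj b v := fun h => nvb h.symm
    by_cases hxb : G.Adj x b
    · exact Or.inl (.broom_of_adj hab hxa.symm hxb.symm hvx.symm nav nbv)
    by_cases hya : G.Adj y a
    · exact Or.inl (.broom_of_adj hab hya.symm hyb.symm hvy.symm nav nbv)
    by_cases hxy : G.Adj x y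
    · exact Or.inl (.broom_of_adj hvy.symm hxy.symm hvx hxa hya nva)
    · exact Or.inr (.pentagon_of_adj hab hyb.symm hvy.symm hvx hxa (fun h => hya h.symm) nav nbv
        (fun h => hxb h.symm) (fun h => hxy h.symm))
  · rintro (h | h) hG
    · exact not_isMatroidGraph_broom (hG.of_hasInducedCopy h)
    · exact not_isMatroidGraph_pentagon (hG.of_hasInducedCopy h)
end

section
/- Let G be a finite simple graph on [r] = {1,…,r} with r ≥ 3 and with no isolated vertices. Then G is a matroid if and only if diam(G) ≤ 2 (any two distinct vertices are adjacent or have a common neighbor) and G contains no induced subgraph isomorphic to the Broom or to the Pentagon. -/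
theorem IsMatroidGraph.not_hasInducedCopy {W V : Type*} {H : SimpleGraph W} {G : SimpleGraph V}
    (hG : IsMatroidGraph G) (hH : ¬ IsMatroidGraph H) : ¬ HasInducedCopy H G := by
  rintro ⟨f, hf, hadj⟩
  refine hH fun v a b hab hva hvb => ?_
  simpa only [hadj] using hG (f v) (f a) (f b) ((hadj a b).2 hab) (hf.ne hva) (hf.ne hvb)

theorem hasInducedCopy_broom {V : Type*} {G : SimpleGraph V} {a b c v : V}
    (hab : G.Adj a b) (hac : G.Adj a c) (hbc : G.Adj b c) (hcv : G.Adj c v)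
    (hva : v ≠ a) (hvb : v ≠ b) (nva : ¬ G.Adj v a) (nvb : ¬ G.Adj v b) :
    HasInducedCopy broom G := by
  refine ⟨![a, b, c, v], ?_, ?_⟩
  · intro i j hij
    have := hab.ne
    have := hac.ne
    have := hbc.ne
    have := hcv.ne
    fin_cases i <;> fin_cases j <;> simp_all
  · intro i j
    fin_cases i <;> fin_cases j <;> simp_all [broom, G.adj_comm]

theorem hasInducedCopy_pentagon {V : Type*} {G : SimpleGraph V} {a b c d e : V}
    (hab : G.Adj a b) (hbc : G.Adj b c) (hcd : G.Adj c d) (hde : G.Adj d e) (hea : G.Adj e a)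
    (nac : ¬ G.Adj a c) (nbd : ¬ G.Adj b d) (nce : ¬ G.Adj c e) (nda : ¬ G.Adj d a)
    (neb : ¬ G.Adj e b) : HasInducedCopy pentagon G := by
  have hadj : ∀ i j, G.Adj (![a, b, c, d, e] i) (![a, b, c, d, e] j) ↔ pentagon.Adj i j := by
    intro i j
    fin_cases i <;> fin_cases j <;>
      simp_all [pentagon, G.adj_comm, Fin.ext_iff, Fin.val_add]
  refine ⟨_, fun i j hij => ?_, hadj⟩
  have hnbr : ∀ k, pentagon.Adj i k ↔ pentagon.Adj j k := fun k => by
    rw [← hadj, ← hadj, hij]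
  simp only [pentagon, SimpleGraph.fromRel_adj] at hnbr
  clear hij
  revert i j
  decide

theorem stmt_14 {r : ℕ} (hr : 3 ≤ r) (G : SimpleGraph (Fin r))
    (hiso : ∀ v : Fin r, ∃ w : Fin r, G.Adj v w) :
    IsMatroidGraph G ↔
      ((∀ u v : Fin r, u ≠ v → G.Adj u v ∨ ∃ w : Fin r, G.Adj u w ∧ G.Adj w v) ∧
        ¬ HasInducedCopy broom G ∧ ¬ HasInducedCopy pentagon G) := by
  constructor
  · intro hG
    refine ⟨fun u v huv => ?_, hG.not_hasInducedCopy not_isMatroidGraph_broom,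
      hG.not_hasInducedCopy not_isMatroidGraph_pentagon⟩
    obtain ⟨w, huw⟩ := hiso u
    by_cases hvw : v = w
    · exact Or.inl (hvw ▸ huw)
    · exact (hG v u w huw huv.symm hvw).imp (fun h => h.symm) fun h => ⟨w, huw, h.symm⟩
  · rintro ⟨hdiam, hbroom, hpent⟩ v a b hab hva hvb
    by_contra! hn
    obtain ⟨nva, nvb⟩ := hn
    obtain ⟨c, hvc, hca⟩ := (hdiam v a hva).resolve_left nva
    obtain ⟨d, hvd, hdb⟩ := (hdiam v b hvb).resolve_left nvb
    by_cases hcb : G.Adj c b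
    · exact hbroom (hasInducedCopy_broom hab hca.symm hcb.symm hvc.symm hva hvb nva nvb)
    by_cases hda : G.Adj d a
    · exact hbroom (hasInducedCopy_broom hab hda.symm hdb.symm hvd.symm hva hvb nva nvb)
    by_cases hcd : G.Adj c d
    · refine hbroom (hasInducedCopy_broom hvc hvd hcd hdb hvb.symm ?_
        (fun h => nvb h.symm) fun h => hcb h.symm)
      rintro rfl
      exact nvb hvc
    · exact hpent (hasInducedCopy_pentagon hvc hca hab hdb.symm hvd.symm nva hcb
        (fun h => hda h.symm) (fun h => nvb h.symm) fun h => hcd h.symm)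
end

section
/- Let G be a finite simple graph on [r] = {1,…,r} with no isolated vertices, let n ≥ 2, and let u ≠ v be vertices with d_G(u,v) ≥ 3 (u and v are not adjacent and have no common neighbor). Define a ∈ ℕ^r by a_u = a_v = n − 1 and a_i = 0 for i ∉ {u,v}. Then x^a ∉ (I_G[{u}]S)^n, x^a ∉ (I_G[{v}]S)^n, and the complex Δ_a(I_G^n) is disconnected: there is no sequence u = p_0, p_1, …, p_ℓ = v of vertices such that x^a ∉ (I_G[{p_i,p_{i+1}}]S)^n for every 0 ≤ i ≤ ℓ−1. -/
open MvPolynomial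

theorem prod_X_pow_pair {R σ : Type*} [CommSemiring R] [Fintype σ] [DecidableEq σ] {u v : σ}
    (huv : u ≠ v) (m : ℕ) :
    (∏ i, (X i : MvPolynomial σ R) ^ (if i = u ∨ i = v then m else 0)) = X u ^ m * X v ^ m := by
  rw [Finset.prod_eq_mul u v huv]
  · simp
  · intro c _ hc
    simp [hc.1, hc.2]
  · simp
  · simp

/-- The generator of a nonedge lies in every localization. -/
theorem nonedge_mem_locSR (K : Type*) [Field K] {r : ℕ} {G : SimpleGraph (Fin r)}
    (F : Finset (Fin r)) {i j : Fin r} (hij : i ≠ j) (hadj : ¬ G.Adj i j) :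
    (if i ∈ F then 1 else X i) * (if j ∈ F then 1 else X j) ∈ locSR K G F := by
  have h : (X i * X j : MvPolynomial (Fin r) K) ∈ SRIdeal K G :=
    Ideal.subset_span (Or.inl ⟨i, j, hij, hadj, rfl⟩)
  simpa [locSR] using Ideal.mem_map_of_mem
    (aeval (fun i : Fin r => if i ∈ F then 1 else X i) :
      MvPolynomial (Fin r) K →ₐ[K] MvPolynomial (Fin r) K) h

theorem X_pow_mul_X_pow_notMem_locSR_pow (K : Type*) [Field K] {r : ℕ} (G : SimpleGraph (Fin r))
    {u v : Fin r} (huv : u ≠ v) (m : ℕ) {n : ℕ} (hn : m < n) :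
    (X u ^ m * X v ^ m : MvPolynomial (Fin r) K) ∉ locSR K G {u} ^ n := by
  classical
  intro hmem
  let φ : MvPolynomial (Fin r) K →ₐ[K] Polynomial K :=
    aeval fun i => if i = u then 1 else if i = v then Polynomial.X else 0
  have hdvd : ∀ i, i ≠ u → (Polynomial.X : Polynomial K) ∣
      (if i = u then 1 else if i = v then Polynomial.X else 0) := by
    intro i hi
    rw [if_neg hi]
    split_ifs <;> simp
  have hπ : ∀ i, φ (if i = u then 1 else X i) =
      if i = u then 1 else if i = v then Polynomial.X else 0 := by
    intro i
    by_cases hi : i = u <;> simp [φ, hi]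
  have hle : (locSR K G {u}).map φ ≤ Ideal.span {Polynomial.X} := by
    rw [Ideal.map_le_iff_le_comap, locSR, Ideal.map_le_iff_le_comap, SRIdeal, Ideal.span_le]
    have hpair : ∀ i j, i ≠ j → (Polynomial.X : Polynomial K) ∣
        (if i = u then 1 else if i = v then Polynomial.X else 0) *
        (if j = u then 1 else if j = v then Polynomial.X else 0) := by
      intro i j hij
      by_cases hi : i = u
      · exact dvd_mul_of_dvd_right (hdvd j fun hj => hij (hi.trans hj.symm)) _
      · exact dvd_mul_of_dvd_left (hdvd i hi) _
    rintro p (⟨i, j, hij, -, rfl⟩ | ⟨i, j, k, hij, -, -, rfl⟩) <;>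
      simp only [SetLike.mem_coe, Ideal.mem_comap, Ideal.mem_span_singleton, map_mul, aeval_X,
        Finset.mem_singleton, hπ]
    · exact hpair i j hij
    · exact dvd_mul_of_dvd_left (hpair i j hij) _
  have h := Ideal.mem_map_of_mem φ hmem
  rw [Ideal.map_pow] at h
  have h' := Ideal.pow_right_mono hle n h
  rw [Ideal.span_singleton_pow, Ideal.mem_span_singleton] at h'
  have hφ : φ (X u ^ m * X v ^ m) = Polynomial.X ^ m := by
    simp [φ, huv.symm]
  rw [hφ, pow_dvd_pow_iff Polynomial.X_ne_zero Polynomial.not_isUnit_X] at h'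
  omega

/-- An edge leaving the closed neighborhood of `u` kills every monomial `x_u^m x_v^m`, when `v` is
at distance at least three from `u`. -/
theorem X_pow_mul_X_pow_mem_locSR_pow (K : Type*) [Field K] {r : ℕ} (G : SimpleGraph (Fin r))
    {u v p q : Fin r} (hadj : ¬ G.Adj u v) (hcom : ¬ ∃ w : Fin r, G.Adj u w ∧ G.Adj w v)
    (hp : p = u ∨ G.Adj u p) (hq : ¬ (q = u ∨ G.Adj u q)) {m n : ℕ} (hn : n ≤ m + m) :
    (X u ^ m * X v ^ m : MvPolynomial (Fin r) K) ∈ locSR K G {p, q} ^ n := by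
  push Not at hq
  by_cases hpq : G.Adj p q
  · have hup : G.Adj u p := hp.resolve_left fun h => hq.2 (h ▸ hpq)
    have hpv : ¬ G.Adj p v := fun h => hcom ⟨p, hup, h⟩
    have hpne : p ≠ v := fun h => hadj (h ▸ hup)
    have hqne : q ≠ v := fun h => hpv (h ▸ hpq)
    have hu : X u ∈ locSR K G {p, q} := by
      simpa [hup.ne, hq.1.symm] using nonedge_mem_locSR K {p, q} hq.1.symm hq.2
    have hv : X v ∈ locSR K G {p, q} := by
      simpa [hpne.symm, hqne.symm] using nonedge_mem_locSR K {p, q} hpne hpv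
    apply Ideal.pow_le_pow_right hn
    rw [pow_add]
    exact Ideal.mul_mem_mul (Ideal.pow_mem_pow hu m) (Ideal.pow_mem_pow hv m)
  · have hne : p ≠ q := by
      rintro rfl
      exact hp.elim hq.1 hq.2
    have h1 : (1 : MvPolynomial (Fin r) K) ∈ locSR K G {p, q} := by
      simpa using nonedge_mem_locSR K {p, q} hne hpq
    rw [(Ideal.eq_top_iff_one _).2 h1, Ideal.top_pow]
    trivial

theorem stmt_15 (K : Type*) [Field K] {r : ℕ} (G : SimpleGraph (Fin r))
    (hiso : ∀ v : Fin r, ∃ w : Fin r, G.Adj v w)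
    (n : ℕ) (hn : 2 ≤ n) (u v : Fin r) (huv : u ≠ v)
    (hadj : ¬ G.Adj u v) (hcom : ¬ ∃ w : Fin r, G.Adj u w ∧ G.Adj w v)
    (a : Fin r → ℕ) (ha : a = fun i => if i = u ∨ i = v then n - 1 else 0) :
    (∏ i, (X i : MvPolynomial (Fin r) K) ^ a i) ∉ (locSR K G {u}) ^ n ∧
    (∏ i, (X i : MvPolynomial (Fin r) K) ^ a i) ∉ (locSR K G {v}) ^ n ∧
    ¬ ∃ (ℓ : ℕ) (p : ℕ → Fin r), p 0 = u ∧ p ℓ = v ∧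
        ∀ i < ℓ, (∏ i', (X i' : MvPolynomial (Fin r) K) ^ a i') ∉
          (locSR K G {p i, p (i + 1)}) ^ n := by
  subst ha
  rw [prod_X_pow_pair huv]
  refine ⟨X_pow_mul_X_pow_notMem_locSR_pow K G huv _ (by omega), ?_, ?_⟩
  · rw [mul_comm]
    exact X_pow_mul_X_pow_notMem_locSR_pow K G huv.symm _ (by omega)
  · rintro ⟨ℓ, p, h0, hℓ, hstep⟩
    have key : ∀ i ≤ ℓ, p i = u ∨ G.Adj u (p i) := by
      intro i
      induction i with
      | zero => exact fun _ => Or.inl h0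
      | succ i ih =>
        intro hi
        by_contra hq
        exact hstep i hi
          (X_pow_mul_X_pow_mem_locSR_pow K G hadj hcom (ih (by omega)) hq (by omega))
    rcases key ℓ le_rfl with h | h
    · exact huv (h.symm.trans hℓ)
    · exact hadj (hℓ ▸ h)
end
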